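/- arXiv:1909.03664 — 2 statements merged into one kernel-verified Lean document; each statement's English description precedes it below -/
import Mathlib

section
/- Consider a path of I cells with free-flow speed v̄ > 0 and, for each cell i, shockwave speed w_i > 0, jam density n̄_i, and critical density ñ_i with 0 < ñ_i < n̄_i and v̄·ñ_i = (n̄_i − ñ_i)·w_i; the capacity of cell i is F_i = v̄·ñ_i, and capacities are nonincreasing along the path (F_{i+1} ≤ F_i for all i). Suppose the densities n_i ≥ 0 and a common flow value f satisfy the equilibrium flow equations: f = min(v̄·n_i, (n̄_{i+1} − n_{i+1})·w_{i+1}, F_i) for every i < I, and f = min(v̄·n_I, F_I). If f < F_i for every cell i (the flow is strictly less than the bottleneck capacity), then every cell is uncongested: n_i < ñ_i and f = v̄·n_i for all i = 1,…,I. -/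
/-- On a path of `I` cells (cell transmission model, uniform free-flow speed `v̄`,
capacity `Fᵢ = v̄·ñᵢ` nonincreasing along the path), if the common equilibrium flow `f`
is strictly less than the capacity of every cell, then every cell is uncongested:
`nᵢ < ñᵢ` and `f = v̄·nᵢ` for all `i = 1,…,I`. -/
theorem subcritical_flow_all_cells_uncongested
    (I : ℕ) (hI : 1 ≤ I)
    (v : ℝ) (hv : 0 < v)
    (n ntil nbar w : ℕ → ℝ)      -- density, critical density, jam density, shockwave speed
    (f : ℝ)                      -- common equilibrium flow
    (hw : ∀ i ∈ Finset.Icc 1 I, 0 < w i)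
    (hntil_pos : ∀ i ∈ Finset.Icc 1 I, 0 < ntil i)
    (hntil_lt : ∀ i ∈ Finset.Icc 1 I, ntil i < nbar i)
    (hfd : ∀ i ∈ Finset.Icc 1 I, v * ntil i = (nbar i - ntil i) * w i)
    -- capacities F_i = v·ñ_i nonincreasing along the path:
    (hcap_mono : ∀ i ∈ Finset.Icc 1 (I - 1), v * ntil (i + 1) ≤ v * ntil i)
    (hn_nonneg : ∀ i ∈ Finset.Icc 1 I, 0 ≤ n i)
    -- equilibrium flow equations:
    (hflow : ∀ i ∈ Finset.Icc 1 (I - 1),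
      f = min (min (v * n i) ((nbar (i + 1) - n (i + 1)) * w (i + 1))) (v * ntil i))
    (hflow_last : f = min (v * n I) (v * ntil I))
    -- flow strictly below every cell's capacity:
    (hsub : ∀ i ∈ Finset.Icc 1 I, f < v * ntil i) :
    ∀ i ∈ Finset.Icc 1 I, n i < ntil i ∧ f = v * n i := by
  have lt_of_flow : ∀ i ∈ Finset.Icc 1 I, f = v * n i → n i < ntil i := fun i hi h =>
    lt_of_mul_lt_mul_left (h ▸ hsub i hi) hv.le
  have flow_eq : ∀ k i, i + k = I → 1 ≤ i → f = v * n i := by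
    intro k
    induction k with
    | zero =>
      rintro i rfl hi
      have hs := hsub i (Finset.mem_Icc.mpr ⟨hi, le_rfl⟩)
      rcases min_choice (v * n i) (v * ntil i) with h | h
      · exact hflow_last.trans h
      · exact absurd (hflow_last.trans h) hs.ne
    | succ k ih =>
      intro i hik hi
      have mem : i ∈ Finset.Icc 1 I := Finset.mem_Icc.mpr ⟨hi, by omega⟩
      have mem_next : i + 1 ∈ Finset.Icc 1 I := Finset.mem_Icc.mpr ⟨by omega, by omega⟩
      have hlt := lt_of_flow (i + 1) mem_next (ih (i + 1) (by omega) (by omega))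
      have hsupply : f < (nbar (i + 1) - n (i + 1)) * w (i + 1) :=
        calc f < v * ntil (i + 1) := hsub _ mem_next
          _ = (nbar (i + 1) - ntil (i + 1)) * w (i + 1) := hfd _ mem_next
          _ < (nbar (i + 1) - n (i + 1)) * w (i + 1) :=
            mul_lt_mul_of_pos_right (sub_lt_sub_left hlt _) (hw _ mem_next)
      have hf := hflow i (Finset.mem_Icc.mpr ⟨hi, by omega⟩)
      rcases min_choice (min (v * n i) ((nbar (i + 1) - n (i + 1)) * w (i + 1)))
        (v * ntil i) with h | h
      · rcases min_choice (v * n i) ((nbar (i + 1) - n (i + 1)) * w (i + 1)) with h' | h'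
        · exact hf.trans (h.trans h')
        · exact absurd (hf.trans (h.trans h')) hsupply.ne
      · exact absurd (hf.trans h) (hsub i mem).ne
  intro i hi
  obtain ⟨h1, h2⟩ := Finset.mem_Icc.mp hi
  have h := flow_eq (I - i) i (by omega) h1
  exact ⟨lt_of_flow i hi h, h⟩
end

section
/- Consider two consecutive cells i−1 and i of a path at equilibrium with common flow f, where each cell j has free-flow speed v̄ > 0, shockwave speed w_j > 0, jam density n̄_j, critical density ñ_j ∈ (0, n̄_j) with v̄·ñ_j = (n̄_j − ñ_j)·w_j, capacity F_j = v̄·ñ_j, and F_i ≤ F_{i−1}. Suppose the equilibrium flow equations hold: f = min(v̄·n_{i−1}, (n̄_i − n_i)·w_i, F_{i−1}) and f equals the flow out of cell i with f = v̄·n_i (cell i uncongested in free flow) and f < F_i. Then cell i−1 is also uncongested: f = v̄·n_{i−1} and n_{i−1} < ñ_{i−1}. In particular, at equilibrium an uncongested cell is never immediately downstream of a congested cell. -/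
/-- Two consecutive cells `i−1` (subscript `1`) and `i` (subscript `2`) at equilibrium with
common flow `f`. If the downstream cell `i` is uncongested in free flow (`f = v̄·n₂` with
`f < F₂ = v̄·ñ₂`) and `F₂ ≤ F₁`, then the upstream cell `i−1` is also uncongested:
`f = v̄·n₁` and `n₁ < ñ₁`. Hence at equilibrium an uncongested cell is never immediately
downstream of a congested cell. -/
theorem uncongested_propagates_upstream
    (v : ℝ) (hv : 0 < v)
    (n1 ntil1 nbar1 w1 : ℝ)   -- upstream cell i−1
    (n2 ntil2 nbar2 w2 : ℝ)   -- downstream cell i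
    (hw1 : 0 < w1) (hw2 : 0 < w2)
    (hntil1 : 0 < ntil1) (hntil1' : ntil1 < nbar1)
    (hntil2 : 0 < ntil2) (hntil2' : ntil2 < nbar2)
    (hfd1 : v * ntil1 = (nbar1 - ntil1) * w1)
    (hfd2 : v * ntil2 = (nbar2 - ntil2) * w2)
    -- capacity nonincreasing: F_i ≤ F_{i−1}:
    (hcap : v * ntil2 ≤ v * ntil1)
    (f : ℝ)
    -- equilibrium flow out of cell i−1:
    (hflow1 : f = min (min (v * n1) ((nbar2 - n2) * w2)) (v * ntil1))
    -- cell i uncongested in free flow: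
    (hflow2 : f = v * n2)
    (hsub : f < v * ntil2) :
    f = v * n1 ∧ n1 < ntil1 := by
  have hn2 : n2 < ntil2 := lt_of_mul_lt_mul_left (hflow2 ▸ hsub) hv.le
  have hsupply : f < (nbar2 - n2) * w2 := by
    have := mul_lt_mul_of_pos_right (sub_lt_sub_left hn2 nbar2) hw2
    linarith
  have hf : f = v * n1 := by
    rcases min_choice (min (v * n1) ((nbar2 - n2) * w2)) (v * ntil1) with h | h
    · rcases min_choice (v * n1) ((nbar2 - n2) * w2) with h' | h' <;> linarith
    · linarith
  exact ⟨hf, lt_of_mul_lt_mul_left (by linarith) hv.le⟩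
end
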